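/- Let A/B and B/C be ring extensions where A, B and C are rings with enough idempotents having a common complete set of idempotents. (a) If A/B and B/C are separable, then A/C is separable. (b) If A/C is separable, then A/B is separable. -/

import Mathlib

open scoped TensorProduct Pointwise
open CategoryTheory

namespace Paper

section Separability

variable {R : Type*} [NonUnitalRing R]

/-- The subgroup of relations defining `R ⊗_S R` as a quotient of `R ⊗_ℤ R`. -/
noncomputable def sepRel (S : Set R) : AddSubgroup (TensorProduct ℤ R R) :=
  AddSubgroup.closure
    {z | ∃ (x y s : R), s ∈ S ∧ z = (x * s) ⊗ₜ[ℤ] y - x ⊗ₜ[ℤ] (s * y)}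

/-- The balanced tensor product `R ⊗_S R`. -/
abbrev SepTens (S : Set R) : Type _ := (TensorProduct ℤ R R) ⧸ sepRel S

/-- The multiplication map `μ : R ⊗_S R → R`. -/
noncomputable def sepMul (S : Set R) : SepTens S →+ R :=
  QuotientAddGroup.lift (sepRel S) (LinearMap.mul' ℤ R).toAddMonoidHom
    (by
      have h : sepRel S ≤ (LinearMap.mul' ℤ R).toAddMonoidHom.ker := by
        rw [sepRel, AddSubgroup.closure_le]
        rintro z ⟨x, y, s, hs, rfl⟩
        simp [AddMonoidHom.mem_ker, LinearMap.mul'_apply, mul_assoc]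
      exact fun x hx => h hx)

/-- The left action of `r ∈ R` on `R ⊗_S R`. -/
noncomputable def sepL (S : Set R) (r : R) : SepTens S →+ SepTens S :=
  QuotientAddGroup.map (sepRel S) (sepRel S)
    (LinearMap.rTensor R (LinearMap.mulLeft ℤ r)).toAddMonoidHom
    (by
      rw [sepRel, AddSubgroup.closure_le]
      rintro z ⟨x, y, s, hs, rfl⟩
      simp only [AddSubgroup.coe_comap, Set.mem_preimage, LinearMap.toAddMonoidHom_coe,
        map_sub, LinearMap.rTensor_tmul, LinearMap.mulLeft_apply, SetLike.mem_coe]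
      apply AddSubgroup.subset_closure
      exact ⟨r * x, y, s, hs, by rw [mul_assoc]⟩)

/-- The right action of `r ∈ R` on `R ⊗_S R`. -/
noncomputable def sepR (S : Set R) (r : R) : SepTens S →+ SepTens S :=
  QuotientAddGroup.map (sepRel S) (sepRel S)
    (LinearMap.lTensor R (LinearMap.mulRight ℤ r)).toAddMonoidHom
    (by
      rw [sepRel, AddSubgroup.closure_le]
      rintro z ⟨x, y, s, hs, rfl⟩
      simp only [AddSubgroup.coe_comap, Set.mem_preimage, LinearMap.toAddMonoidHom_coe,
        map_sub, LinearMap.lTensor_tmul, LinearMap.mulRight_apply, SetLike.mem_coe]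
      apply AddSubgroup.subset_closure
      exact ⟨x, y * r, s, hs, by rw [mul_assoc]⟩)

/-- The ring extension `R/S` is separable: the multiplication map `μ : R ⊗_S R → R`
admits a section `δ` in the category of `R`-bimodules. -/
def IsSep (S : Set R) : Prop :=
  ∃ δ : R →+ SepTens S,
    (∀ x, sepMul S (δ x) = x) ∧
    (∀ r x, δ (r * x) = sepL S r (δ x)) ∧
    (∀ r x, δ (x * r) = sepR S r (δ x))

end Separability

/-- The ring `A` has enough idempotents, with `U` a complete set of (nonzero, pairwise
orthogonal) idempotents: `A = ⊕_{u ∈ U} Au = ⊕_{u ∈ U} uA`. -/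
structure EnoughIdem (A : Type*) [NonUnitalRing A] (U : Set A) : Prop where
  nonempty : U.Nonempty
  ne_zero : ∀ u ∈ U, u ≠ 0
  idem : ∀ u ∈ U, u * u = u
  orthogonal : ∀ u ∈ U, ∀ v ∈ U, u ≠ v → u * v = 0
  indep_left : iSupIndep fun u : U => (AddMonoidHom.mulRight (u : A)).range
  span_left : ⨆ u : U, (AddMonoidHom.mulRight (u : A)).range = ⊤
  indep_right : iSupIndep fun u : U => (AddMonoidHom.mulLeft (u : A)).range
  span_right : ⨆ u : U, (AddMonoidHom.mulLeft (u : A)).range = ⊤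

section BalancedTensor

variable {R : Type*} [NonUnitalRing R] (S : Set R)

/-- The class of the pure tensor `x ⊗ y` in `R ⊗_S R`. -/
noncomputable def sepTmul (x y : R) : SepTens S := QuotientAddGroup.mk (x ⊗ₜ[ℤ] y)

lemma sepMul_sepTmul (x y : R) : sepMul S (sepTmul S x y) = x * y := rfl

lemma sepL_sepTmul (r x y : R) : sepL S r (sepTmul S x y) = sepTmul S (r * x) y := rfl

lemma sepR_sepTmul (r x y : R) : sepR S r (sepTmul S x y) = sepTmul S x (y * r) := rfl

lemma sepTmul_add_left (x x' y : R) :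
    sepTmul S (x + x') y = sepTmul S x y + sepTmul S x' y := by
  simp [sepTmul, TensorProduct.add_tmul]

lemma sepTmul_add_right (x y y' : R) :
    sepTmul S x (y + y') = sepTmul S x y + sepTmul S x y' := by
  simp [sepTmul, TensorProduct.tmul_add]

variable {S}

lemma sepTmul_balanced (x y : R) {s : R} (hs : s ∈ S) :
    sepTmul S (x * s) y = sepTmul S x (s * y) := by
  refine QuotientAddGroup.eq_iff_sub_mem.2 (AddSubgroup.subset_closure ?_)
  exact ⟨x, y, s, hs, rfl⟩

lemma SepTens.addHom_ext {M : Type*} [AddCommGroup M] {f g : SepTens S →+ M}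
    (h : ∀ x y, f (sepTmul S x y) = g (sepTmul S x y)) : f = g := by
  refine AddMonoidHom.ext fun t => ?_
  induction t using QuotientAddGroup.induction_on with
  | H t =>
    induction t using TensorProduct.induction_on with
    | zero => exact (map_zero f).trans (map_zero g).symm
    | tmul x y => exact h x y
    | add a b ha hb => rw [QuotientAddGroup.mk_add, map_add, map_add, ha, hb]

/-- The additive map out of `R ⊗_S R` induced by an `S`-balanced biadditive map. -/
noncomputable def sepLift {M : Type*} [AddCommGroup M] (f : R →+ R →+ M)
    (hf : ∀ x y, ∀ s ∈ S, f (x * s) y = f x (s * y)) : SepTens S →+ M :=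
  QuotientAddGroup.lift (sepRel S)
    (TensorProduct.liftAddHom f fun n x y => by simp)
    (by
      rw [sepRel, AddSubgroup.closure_le]
      rintro z ⟨x, y, s, hs, rfl⟩
      simp [AddMonoidHom.mem_ker, hf x y s hs])

lemma sepL_add (r r' : R) : sepL S (r + r') = sepL S r + sepL S r' :=
  SepTens.addHom_ext fun x y => by
    simp [sepL_sepTmul, add_mul, sepTmul_add_left]

lemma sepR_add (r r' : R) : sepR S (r + r') = sepR S r + sepR S r' :=
  SepTens.addHom_ext fun x y => by
    simp [sepR_sepTmul, mul_add, sepTmul_add_right]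

variable (S) in
/-- The left action of `R` on `R ⊗_S R`, as an additive map. -/
noncomputable def sepLHom : R →+ SepTens S →+ SepTens S :=
  AddMonoidHom.mk' (sepL S) sepL_add

lemma sepL_zero : sepL S (0 : R) = 0 := map_zero (sepLHom S)

lemma sepL_mul (r r' : R) (t : SepTens S) : sepL S (r * r') t = sepL S r (sepL S r' t) :=
  DFunLike.congr_fun (SepTens.addHom_ext (f := sepL S (r * r'))
    (g := (sepL S r).comp (sepL S r')) fun x y => by
      simp [sepL_sepTmul, mul_assoc]) t

lemma sepR_mul (r r' : R) (t : SepTens S) : sepR S (r * r') t = sepR S r' (sepR S r t) :=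
  DFunLike.congr_fun (SepTens.addHom_ext (f := sepR S (r * r'))
    (g := (sepR S r').comp (sepR S r)) fun x y => by
      simp [sepR_sepTmul, mul_assoc]) t

lemma sepL_sepR (r r' : R) (t : SepTens S) : sepL S r (sepR S r' t) = sepR S r' (sepL S r t) :=
  DFunLike.congr_fun (SepTens.addHom_ext (f := (sepL S r).comp (sepR S r'))
    (g := (sepR S r').comp (sepL S r)) fun x y => by
      simp [sepL_sepTmul, sepR_sepTmul]) t

lemma sepMul_sepL (r : R) (t : SepTens S) : sepMul S (sepL S r t) = r * sepMul S t :=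
  DFunLike.congr_fun (SepTens.addHom_ext (f := (sepMul S).comp (sepL S r))
    (g := (AddMonoidHom.mulLeft r).comp (sepMul S)) fun x y => by
      simp [sepL_sepTmul, sepMul_sepTmul, mul_assoc]) t

lemma sepMul_sepR (r : R) (t : SepTens S) : sepMul S (sepR S r t) = sepMul S t * r :=
  DFunLike.congr_fun (SepTens.addHom_ext (f := (sepMul S).comp (sepR S r))
    (g := (AddMonoidHom.mulRight r).comp (sepMul S)) fun x y => by
      simp [sepR_sepTmul, sepMul_sepTmul, mul_assoc]) t

section Map

variable {R' : Type*} [NonUnitalRing R'] {S' : Set R'} (f : R →ₙ+* R') (hf : ∀ s ∈ S, f s ∈ S')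

/-- The map `R ⊗_S R → R' ⊗_{S'} R'` induced by a ring homomorphism carrying `S` into `S'`. -/
noncomputable def sepMap : SepTens S →+ SepTens S' :=
  sepLift
    (AddMonoidHom.mk'
      (fun x => AddMonoidHom.mk' (fun y => sepTmul S' (f x) (f y)) fun y y' => by
        rw [map_add, sepTmul_add_right])
      fun x x' => by
        ext y
        simp [sepTmul_add_left])
    fun x y s hs => by
      simpa using sepTmul_balanced (f x) (f y) (hf s hs)

lemma sepMap_sepTmul (x y : R) :
    sepMap f hf (sepTmul S x y) = sepTmul S' (f x) (f y) := rfl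

lemma sepMul_sepMap (t : SepTens S) : sepMul S' (sepMap f hf t) = f (sepMul S t) :=
  DFunLike.congr_fun (SepTens.addHom_ext (f := (sepMul S').comp (sepMap f hf))
    (g := (f : R →+ R').comp (sepMul S)) fun x y => by
      simp [sepMap_sepTmul, sepMul_sepTmul]) t

lemma sepMap_sepL (r : R) (t : SepTens S) :
    sepMap f hf (sepL S r t) = sepL S' (f r) (sepMap f hf t) :=
  DFunLike.congr_fun (SepTens.addHom_ext (f := (sepMap f hf).comp (sepL S r))
    (g := (sepL S' (f r)).comp (sepMap f hf)) fun x y => by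
      simp [sepMap_sepTmul, sepL_sepTmul]) t

lemma sepMap_sepR (r : R) (t : SepTens S) :
    sepMap f hf (sepR S r t) = sepR S' (f r) (sepMap f hf t) :=
  DFunLike.congr_fun (SepTens.addHom_ext (f := (sepMap f hf).comp (sepR S r))
    (g := (sepR S' (f r)).comp (sepMap f hf)) fun x y => by
      simp [sepMap_sepTmul, sepR_sepTmul]) t

end Map

/-- A separable extension stays separable when the subring is enlarged. -/
lemma IsSep.mono {T : Set R} (hST : S ⊆ T) (h : IsSep S) : IsSep T := by
  obtain ⟨δ, hμ, hl, hr⟩ := h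
  refine ⟨(sepMap (NonUnitalRingHom.id R) hST).comp δ, fun x => ?_, fun r x => ?_, fun r x => ?_⟩
  · exact (sepMul_sepMap (NonUnitalRingHom.id R) hST _).trans (hμ x)
  · exact (congrArg _ (hl r x)).trans (sepMap_sepL (NonUnitalRingHom.id R) hST r _)
  · exact (congrArg _ (hr r x)).trans (sepMap_sepR (NonUnitalRingHom.id R) hST r _)

end BalancedTensor

section EnoughIdem

variable {A : Type*} [NonUnitalRing A] {U : Set A}

lemma EnoughIdem.hasFiniteSupport_and_finsum (hA : EnoughIdem A U) (x : A) :
    (fun u : U => x * (u : A)).HasFiniteSupport ∧ ∑ᶠ u : U, x * (u : A) = x := by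
  have hx : x ∈ ⨆ u : U, (AddMonoidHom.mulRight (u : A)).range := hA.span_left ▸ trivial
  refine AddSubgroup.iSup_induction _
    (C := fun x => (fun u : U => x * (u : A)).HasFiniteSupport ∧
    ∑ᶠ u : U, x * (u : A) = x) hx ?_ ?_ ?_
  · rintro v _ ⟨a, rfl⟩
    have hz : ∀ u : U, u ≠ v → AddMonoidHom.mulRight (v : A) a * (u : A) = 0 := fun u hu => by
      rw [AddMonoidHom.mulRight_apply, mul_assoc,
        hA.orthogonal v v.2 u u.2 fun h => hu (Subtype.ext h.symm), mul_zero]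
    refine ⟨(Set.finite_singleton v).subset fun u hu => ?_, ?_⟩
    · by_contra h
      exact hu (hz u h)
    · rw [finsum_eq_single _ v hz, AddMonoidHom.mulRight_apply, mul_assoc, hA.idem v v.2]
  · simp [Function.HasFiniteSupport]
  · intro a b ha hb
    simp only [add_mul]
    refine ⟨(ha.1.union hb.1).subset (Function.support_add _ _), ?_⟩
    rw [finsum_add_distrib ha.1 hb.1, ha.2, hb.2]

lemma EnoughIdem.hasFiniteSupport (hA : EnoughIdem A U) (x : A) :
    (fun u : U => x * (u : A)).HasFiniteSupport :=
  (hA.hasFiniteSupport_and_finsum x).1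

lemma EnoughIdem.finsum_mul (hA : EnoughIdem A U) (x : A) : ∑ᶠ u : U, x * (u : A) = x :=
  (hA.hasFiniteSupport_and_finsum x).2

variable {S : Set A} {d : U → SepTens S}

lemma EnoughIdem.hasFiniteSupport_sepL (hA : EnoughIdem A U)
    (hd : ∀ u : U, sepL S (u : A) (d u) = d u) (x y : A) :
    (fun u : U => sepL S x (sepR S y (d u))).HasFiniteSupport := by
  refine (hA.hasFiniteSupport x).subset fun u hu hxu => hu ?_
  change x * (u : A) = 0 at hxu
  change sepL S x (sepR S y (d u)) = 0
  rw [← hd u, ← sepL_sepR, ← sepL_mul, hxu, sepL_zero, AddMonoidHom.zero_apply]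

/-- The biadditive map `(x, y) ↦ ∑ u ∈ U, x • d u • y`. -/
noncomputable def EnoughIdem.sandwich (hA : EnoughIdem A U)
    (hd : ∀ u : U, sepL S (u : A) (d u) = d u) : A →+ A →+ SepTens S :=
  AddMonoidHom.mk'
    (fun x => AddMonoidHom.mk' (fun y => ∑ᶠ u : U, sepL S x (sepR S y (d u))) fun y y' => by
      simp only [sepR_add, AddMonoidHom.add_apply, map_add]
      exact finsum_add_distrib (hA.hasFiniteSupport_sepL hd x y)
        (hA.hasFiniteSupport_sepL hd x y'))
    fun x x' => by
      ext y
      simp only [AddMonoidHom.mk'_apply, sepL_add, AddMonoidHom.add_apply]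
      exact finsum_add_distrib (hA.hasFiniteSupport_sepL hd x y)
        (hA.hasFiniteSupport_sepL hd x' y)

lemma EnoughIdem.sandwich_apply (hA : EnoughIdem A U)
    (hd : ∀ u : U, sepL S (u : A) (d u) = d u) (x y : A) :
    hA.sandwich hd x y = ∑ᶠ u : U, sepL S x (sepR S y (d u)) := rfl

lemma EnoughIdem.sandwich_mul_left (hA : EnoughIdem A U)
    (hd : ∀ u : U, sepL S (u : A) (d u) = d u) (r x y : A) :
    hA.sandwich hd (r * x) y = sepL S r (hA.sandwich hd x y) := by
  simp only [sandwich_apply, map_finsum (sepL S r) (hA.hasFiniteSupport_sepL hd x y), sepL_mul]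

lemma EnoughIdem.sandwich_mul_right (hA : EnoughIdem A U)
    (hd : ∀ u : U, sepL S (u : A) (d u) = d u) (r x y : A) :
    hA.sandwich hd x (y * r) = sepR S r (hA.sandwich hd x y) := by
  rw [sandwich_apply, sandwich_apply, map_finsum (sepR S r) (hA.hasFiniteSupport_sepL hd x y)]
  simp only [sepR_mul, sepL_sepR]

lemma EnoughIdem.sepMul_sandwich (hA : EnoughIdem A U)
    (hd : ∀ u : U, sepL S (u : A) (d u) = d u) (hμ : ∀ u : U, sepMul S (d u) = u) (x y : A) :
    sepMul S (hA.sandwich hd x y) = x * y := by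
  rw [sandwich_apply, map_finsum (sepMul S) (hA.hasFiniteSupport_sepL hd x y)]
  simp only [sepMul_sepL, sepMul_sepR, hμ, ← mul_assoc]
  have h := map_finsum (AddMonoidHom.mulRight y) (hA.hasFiniteSupport x)
  rw [hA.finsum_mul] at h
  exact h.symm

lemma EnoughIdem.finsum_sepL_mul (hA : EnoughIdem A U) (x : A) (t : SepTens S) :
    ∑ᶠ u : U, sepL S (x * (u : A)) t = sepL S x t := by
  have h := map_finsum ((AddMonoidHom.eval t).comp (sepLHom S)) (hA.hasFiniteSupport x)
  rw [hA.finsum_mul] at h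
  exact h.symm

end EnoughIdem

/-- Separability is transitive along `C ⊆ B ⊆ A` when `A` has enough idempotents, all in `B`. -/
lemma IsSep.trans {A : Type*} [NonUnitalRing A] {B : NonUnitalSubring A} {C : Set A}
    {U : Set A} (hA : EnoughIdem A U) (hUB : ∀ u ∈ U, u ∈ B)
    (hAB : IsSep (B : Set A)) (hBC : IsSep {x : B | (x : A) ∈ C}) : IsSep C := by
  obtain ⟨δ, hμ, hl, hr⟩ := hAB
  obtain ⟨ε, hμ', hl', hr'⟩ := hBC
  let i : B →ₙ+* A := NonUnitalSubringClass.subtype B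
  let ι : SepTens {x : B | (x : A) ∈ C} →+ SepTens C := sepMap i fun s hs => hs
  let e : B →+ SepTens C := ι.comp ε
  have el (b x : B) : e (b * x) = sepL C (b : A) (e x) :=
    (congrArg ι (hl' b x)).trans (sepMap_sepL i (fun s hs => hs) b (ε x))
  have er (b x : B) : e (x * b) = sepR C (b : A) (e x) :=
    (congrArg ι (hr' b x)).trans (sepMap_sepR i (fun s hs => hs) b (ε x))
  have eμ (b : B) : sepMul C (e b) = (b : A) :=
    (sepMul_sepMap i (fun s hs => hs) (ε b)).trans (congrArg i (hμ' b))
  let w : U → B := fun u => ⟨u, hUB u u.2⟩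
  have hd (u : U) : sepL C (u : A) (e (w u)) = e (w u) := by
    have h := el (w u) (w u)
    rwa [show w u * w u = w u from Subtype.ext (hA.idem u u.2), eq_comm] at h
  have hfin (b : B) : (fun u : U => b * w u).HasFiniteSupport :=
    (hA.hasFiniteSupport (b : A)).subset fun u hu h => hu (Subtype.ext h)
  have hsum (b : B) : ∑ᶠ u : U, b * w u = b := by
    refine Subtype.ext ?_
    have h := map_finsum i (hfin b)
    exact h.trans (hA.finsum_mul (b : A))
  have hbal (x y : A) (b : A) (hb : b ∈ (B : Set A)) :
      hA.sandwich hd (x * b) y = hA.sandwich hd x (b * y) := by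
    lift b to B using hb
    have hleft : hA.sandwich hd (x * (b : A)) y = sepL C x (sepR C y (e b)) := by
      have h := map_finsum ((sepL C x).comp ((sepR C y).comp e)) (hfin b)
      rw [hsum] at h
      rw [EnoughIdem.sandwich_apply]
      simp only [sepL_mul, sepL_sepR _ y, ← el]
      simpa only [AddMonoidHom.comp_apply, sepL_sepR] using h.symm
    have hright : hA.sandwich hd x ((b : A) * y) = sepL C x (sepR C y (e b)) := by
      rw [EnoughIdem.sandwich_apply, ← hA.finsum_sepL_mul x]
      refine finsum_congr fun u => ?_
      rw [sepR_mul, ← er, el, ← sepL_sepR, ← sepL_mul]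
    rw [hleft, hright]
  let φ : SepTens (B : Set A) →+ SepTens C := sepLift (hA.sandwich hd) hbal
  have φμ : (sepMul C).comp φ = sepMul (B : Set A) := SepTens.addHom_ext fun x y =>
    hA.sepMul_sandwich hd (fun u => eμ (w u)) x y
  have φl (r : A) : φ.comp (sepL (B : Set A) r) = (sepL C r).comp φ :=
    SepTens.addHom_ext fun x y => hA.sandwich_mul_left hd r x y
  have φr (r : A) : φ.comp (sepR (B : Set A) r) = (sepR C r).comp φ :=
    SepTens.addHom_ext fun x y => hA.sandwich_mul_right hd r x y
  refine ⟨φ.comp δ, fun x => ?_, fun r x => ?_, fun r x => ?_⟩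
  · exact (DFunLike.congr_fun φμ (δ x)).trans (hμ x)
  · rw [AddMonoidHom.comp_apply, hl]
    exact DFunLike.congr_fun (φl r) (δ x)
  · rw [AddMonoidHom.comp_apply, hr]
    exact DFunLike.congr_fun (φr r) (δ x)

/-- Let `A/B` and `B/C` be ring extensions of rings with enough idempotents
having a common complete set `U` of idempotents.  (a) If `A/B` and `B/C` are separable, then
`A/C` is separable.  (b) If `A/C` is separable, then `A/B` is separable. -/
theorem separable_transitivity
    {A : Type*} [NonUnitalRing A] (B C : NonUnitalSubring A) (hCB : C ≤ B)
    (U : Set A) (hUC : ∀ u ∈ U, u ∈ C)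
    (hA : EnoughIdem A U)
    (hB : EnoughIdem B {x : B | (x : A) ∈ U})
    (hC : EnoughIdem C {x : C | (x : A) ∈ U}) :
    ((IsSep (B : Set A) ∧ IsSep {x : B | (x : A) ∈ C}) → IsSep (C : Set A)) ∧
      (IsSep (C : Set A) → IsSep (B : Set A)) := by
  exact ⟨fun h => h.1.trans hA (fun u hu => hCB (hUC u hu)) h.2, fun h => h.mono hCB⟩

end Paper
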